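/- Let α be a finite nonempty type and let p, q : α → ℝ be probability mass functions with full support, i.e., p(x) > 0 and q(x) > 0 for all x, and Σ_x p(x) = Σ_x q(x) = 1. Define V*(p,q) = Σ_x p(x)·log(p(x)/(p(x)+q(x))) + Σ_x q(x)·log(q(x)/(p(x)+q(x))). Then V*(p,q) ≥ −log 4, and V*(p,q) = −log 4 if and only if p = q. -/

import Mathlib

open Finset

lemma mul_log_div_add_gt {a b : ℝ} (ha : 0 < a) (hb : 0 < b) (hab : a ≠ b) :
    (a - b) / 2 < a * (Real.log (a / (a + b)) + Real.log 2) := by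
  have hne : (a + b) / (2 * a) ≠ 1 := by
    rw [Ne, div_eq_one_iff_eq (by positivity)]
    intro h
    exact hab (by linarith)
  have h := Real.log_lt_sub_one_of_pos (by positivity : 0 < (a + b) / (2 * a)) hne
  have hlog : Real.log ((a + b) / (2 * a)) = -(Real.log (a / (a + b)) + Real.log 2) := by
    rw [← Real.log_mul (by positivity) (by norm_num), ← Real.log_inv]
    congr 1
    field_simp
  rw [hlog] at h
  have h' := mul_lt_mul_of_pos_left h ha
  have hmul : a * ((a + b) / (2 * a) - 1) = (b - a) / 2 := by
    field_simp
    ring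
  linarith

lemma log_self_div_self_add_self {a : ℝ} (ha : 0 < a) :
    Real.log (a / (a + a)) + Real.log 2 = 0 := by
  rw [← Real.log_mul (by positivity) (by norm_num),
    show a / (a + a) * 2 = 1 by field_simp; norm_num, Real.log_one]

/-- The pointwise Jensen–Shannon integrand, without the factor `1 / 2`. -/
noncomputable def jensenShannonTerm (a b : ℝ) : ℝ :=
  a * (Real.log (a / (a + b)) + Real.log 2) + b * (Real.log (b / (a + b)) + Real.log 2)

lemma jensenShannonTerm_self {a : ℝ} (ha : 0 < a) : jensenShannonTerm a a = 0 := by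
  simp [jensenShannonTerm, log_self_div_self_add_self ha]

lemma jensenShannonTerm_pos {a b : ℝ} (ha : 0 < a) (hb : 0 < b) (hab : a ≠ b) :
    0 < jensenShannonTerm a b := by
  have h₁ := mul_log_div_add_gt ha hb hab
  have h₂ := mul_log_div_add_gt hb ha hab.symm
  rw [add_comm b a] at h₂
  unfold jensenShannonTerm
  linarith

lemma jensenShannonTerm_nonneg {a b : ℝ} (ha : 0 < a) (hb : 0 < b) :
    0 ≤ jensenShannonTerm a b := by
  rcases eq_or_ne a b with rfl | hab
  · exact (jensenShannonTerm_self ha).ge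
  · exact (jensenShannonTerm_pos ha hb hab).le

lemma sum_jensenShannonTerm {α : Type*} [Fintype α] {p q : α → ℝ}
    (hp1 : ∑ x, p x = 1) (hq1 : ∑ x, q x = 1) :
    ∑ x, jensenShannonTerm (p x) (q x) =
      ∑ x, p x * Real.log (p x / (p x + q x)) +
        ∑ x, q x * Real.log (q x / (p x + q x)) + Real.log 4 := by
  have h4 : Real.log 4 = Real.log 2 + Real.log 2 := by
    rw [← Real.log_mul (by norm_num) (by norm_num)]
    norm_num
  simp only [jensenShannonTerm, mul_add, Finset.sum_add_distrib, ← Finset.sum_mul, hp1, hq1, h4]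
  ring

/-- Proposition 2: the optimal value functional is at least `-log 4`, with equality
iff the two distributions coincide. -/
theorem value_ge_neg_log4 {α : Type*} [Fintype α] [Nonempty α]
    (p q : α → ℝ) (hp : ∀ x, 0 < p x) (hq : ∀ x, 0 < q x)
    (hp1 : ∑ x, p x = 1) (hq1 : ∑ x, q x = 1) :
    (-Real.log 4 ≤
      ∑ x, p x * Real.log (p x / (p x + q x)) +
        ∑ x, q x * Real.log (q x / (p x + q x))) ∧
    ((∑ x, p x * Real.log (p x / (p x + q x)) +
        ∑ x, q x * Real.log (q x / (p x + q x)) = -Real.log 4) ↔ p = q) := by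
  have hsum := sum_jensenShannonTerm hp1 hq1
  have hnonneg : ∀ x ∈ univ, 0 ≤ jensenShannonTerm (p x) (q x) :=
    fun x _ => jensenShannonTerm_nonneg (hp x) (hq x)
  refine ⟨by linarith [Finset.sum_nonneg hnonneg], fun h => ?_, ?_⟩
  · have hzero : ∑ x, jensenShannonTerm (p x) (q x) = 0 := by linarith
    rw [Finset.sum_eq_zero_iff_of_nonneg hnonneg] at hzero
    funext x
    by_contra hx
    exact (jensenShannonTerm_pos (hp x) (hq x) hx).ne' (hzero x (mem_univ x))
  · rintro rfl
    rw [Finset.sum_eq_zero fun x _ => jensenShannonTerm_self (hp x)] at hsum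
    linarith
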